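/- Let k ≥ 3 be an integer and let x₁ ≤ x₂ ≤ ⋯ ≤ x_k be real numbers with x_k − x₁ = d. Then −d^k / C(k, m) ≤ ψ_k(x₁, …, x_k) ≤ d^k / k, where m = 2 if k is even and m = 1 if k is odd, and C(k, m) is the binomial coefficient. In particular, the k-th central moment kernel restricted to ordered k-tuples whose range equals d takes values in the interval [−C(k, (3+(−1)^k)/2)^{−1} d^k, (1/k) d^k]. -/

import Mathlib

open Finset

/-- The `k`-th central moment kernel (Heffernan 1997). -/
noncomputable def psi (k : ℕ) (x : Fin k → ℝ) : ℝ :=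
  (∑ j ∈ Finset.range (k - 1), (-1 : ℝ) ^ j * (1 / ((k : ℝ) - j)) *
      ∑ i1 : Fin k, ∑ S ∈ Finset.powersetCard j (Finset.univ.erase i1),
        x i1 ^ (k - j) * ∏ i ∈ S, x i)
    + (-1 : ℝ) ^ (k - 1) * ((k : ℝ) - 1) * ∏ i, x i

/-- The product of `t - y l` over the first `p` nodes. -/
noncomputable def nodeProd (y : ℕ → ℝ) (p : ℕ) (t : ℝ) : ℝ := ∏ l ∈ range p, (t - y l)

/-- The potential `∑_{q ≤ p} C(k, q) (∏_{l < q} (t - y l)) (b - t)^(k - q)`. -/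
noncomputable def potential (k : ℕ) (y : ℕ → ℝ) (b : ℝ) (p : ℕ) (t : ℝ) : ℝ :=
  ∑ q ∈ range (p + 1), (k.choose q : ℝ) * nodeProd y q t * (b - t) ^ (k - q)

lemma nodeProd_succ (y : ℕ → ℝ) (p : ℕ) (t : ℝ) :
    nodeProd y (p + 1) t = nodeProd y p t * (t - y p) := prod_range_succ _ _

lemma nodeProd_nonneg {y : ℕ → ℝ} {p : ℕ} {t : ℝ} (h : ∀ l < p, y l ≤ t) :
    0 ≤ nodeProd y p t :=
  prod_nonneg fun l hl => sub_nonneg.2 (h l (mem_range.1 hl))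

lemma nodeProd_succ_self (y : ℕ → ℝ) (p : ℕ) : nodeProd y (p + 1) (y p) = 0 := by
  simp [nodeProd_succ]

lemma differentiable_nodeProd (y : ℕ → ℝ) (p : ℕ) : Differentiable ℝ (nodeProd y p) := by
  unfold nodeProd
  fun_prop

lemma differentiable_potential (k : ℕ) (y : ℕ → ℝ) (b : ℝ) (p : ℕ) :
    Differentiable ℝ (potential k y b p) := by
  unfold potential
  have := differentiable_nodeProd y
  fun_prop

lemma potential_succ (k : ℕ) (y : ℕ → ℝ) (b : ℝ) (p : ℕ) (t : ℝ) :
    potential k y b (p + 1) t = potential k y b p t +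
      (k.choose (p + 1) : ℝ) * nodeProd y (p + 1) t * (b - t) ^ (k - (p + 1)) :=
  sum_range_succ _ _

lemma potential_succ_node (k : ℕ) (y : ℕ → ℝ) (b : ℝ) (p : ℕ) :
    potential k y b (p + 1) (y p) = potential k y b p (y p) := by
  simp [potential_succ, nodeProd_succ_self]

lemma potential_zero (k : ℕ) (y : ℕ → ℝ) (b t : ℝ) : potential k y b 0 t = (b - t) ^ k := by
  simp [potential, nodeProd]

lemma potential_nonneg {k : ℕ} {y : ℕ → ℝ} {b : ℝ} {p : ℕ} {t : ℝ}
    (h : ∀ l < p, y l ≤ t) (hb : t ≤ b) : 0 ≤ potential k y b p t := by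
  refine sum_nonneg fun q hq => ?_
  have := nodeProd_nonneg (y := y) (p := q) (t := t)
    fun l hl => h l (by have := mem_range.1 hq; omega)
  have : 0 ≤ b - t := sub_nonneg.2 hb
  positivity

lemma deriv_nodeProd_succ_le {y : ℕ → ℝ} (hy : Monotone y) (p : ℕ) {t : ℝ}
    (h : ∀ l < p + 1, y l ≤ t) :
    deriv (nodeProd y (p + 1)) t ≤ (p + 1) * nodeProd y p t := by
  induction p with
  | zero =>
    have : nodeProd y (0 + 1) = fun t => t - y 0 := by ext; simp [nodeProd]
    rw [this]; simp [nodeProd]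
  | succ p ih =>
    have e : nodeProd y (p + 1 + 1) = fun t => nodeProd y (p + 1) t * (t - y (p + 1)) := by
      ext t; exact nodeProd_succ _ _ _
    have hd : HasDerivAt (nodeProd y (p + 1 + 1)) (deriv (nodeProd y (p + 1)) t *
        (t - y (p + 1)) + nodeProd y (p + 1) t * 1) t := by
      rw [e]
      exact (differentiable_nodeProd y (p + 1) t).hasDerivAt.mul
        ((hasDerivAt_id t).sub_const _)
    rw [hd.deriv]
    have h1 := ih fun l hl => h l (by omega)
    have h2 : 0 ≤ t - y (p + 1) := sub_nonneg.2 (h _ (by omega))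
    have h3 : y p ≤ y (p + 1) := hy (by omega)
    have h4 : 0 ≤ nodeProd y p t := nodeProd_nonneg fun l hl => h l (by omega)
    have h5 := mul_le_mul_of_nonneg_right h1 h2
    have h6 : 0 ≤ ((p : ℝ) + 1) * nodeProd y p t * (y (p + 1) - y p) :=
      mul_nonneg (by positivity) (sub_nonneg.2 h3)
    rw [nodeProd_succ] at *
    push_cast
    nlinarith

lemma deriv_potential_le {k : ℕ} {y : ℕ → ℝ} (hy : Monotone y) {b : ℝ} {p : ℕ} (hp : p < k)
    {t : ℝ} (h : ∀ l < p, y l ≤ t) (hb : t ≤ b) :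
    deriv (potential k y b p) t ≤
      -((k.choose p : ℝ) * (k - p : ℕ) * nodeProd y p t * (b - t) ^ (k - p - 1)) := by
  have hpow (n : ℕ) : HasDerivAt (fun t => (b - t) ^ n) (n * (b - t) ^ (n - 1) * (-1)) t :=
    ((hasDerivAt_id t).const_sub b).pow n
  induction p with
  | zero =>
    have : potential k y b 0 = fun t => (b - t) ^ k := by ext; exact potential_zero _ _ _ _
    rw [this, (hpow k).deriv]
    simp [nodeProd]
  | succ p ih =>
    have e : potential k y b (p + 1) = fun t => potential k y b p t +
      (k.choose (p + 1) : ℝ) * nodeProd y (p + 1) t * (b - t) ^ (k - (p + 1)) := by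
      ext t; exact potential_succ _ _ _ _ _
    have hd : HasDerivAt (potential k y b (p + 1)) (deriv (potential k y b p) t +
        ((k.choose (p + 1) : ℝ) * deriv (nodeProd y (p + 1)) t * (b - t) ^ (k - (p + 1)) +
          (k.choose (p + 1) : ℝ) * nodeProd y (p + 1) t *
          ((k - (p + 1) : ℕ) * (b - t) ^ (k - (p + 1) - 1) * (-1)))) t := by
      rw [e]
      exact (differentiable_potential k y b p t).hasDerivAt.add
        (((differentiable_nodeProd y (p + 1) t).hasDerivAt.const_mul _).mul (hpow _))
    rw [hd.deriv]
    have h1 := ih (by omega) fun l hl => h l (by omega)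
    have h2 := deriv_nodeProd_succ_le hy p h
    have hc : (k.choose (p + 1) : ℝ) * (p + 1) = k.choose p * (k - p : ℕ) := by
      exact_mod_cast Nat.choose_succ_right_eq k p
    have h3 : (k.choose (p + 1) : ℝ) * deriv (nodeProd y (p + 1)) t * (b - t) ^ (k - (p + 1)) ≤
        (k.choose (p + 1) : ℝ) * ((p + 1) * nodeProd y p t) * (b - t) ^ (k - (p + 1)) := by
      have : 0 ≤ b - t := sub_nonneg.2 hb
      gcongr
    rw [← mul_assoc, hc, show k - (p + 1) = k - p - 1 by omega] at h3
    rw [show k - (p + 1) = k - p - 1 by omega]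
    linarith

lemma neg_one_pow_mul_prod_erase_le {k : ℕ} {y : ℕ → ℝ} {b c ε : ℝ} {p : ℕ}
    (hc : ε * (-1) ^ (k - p - 1) ≤ c) (hc0 : 0 ≤ c) {i : ℕ} (hi : i ∈ Ico p k) {t : ℝ}
    (h : ∀ l < p, y l ≤ t) (h' : ∀ l ∈ Ico p k, t ≤ y l) (hb : ∀ l ∈ Ico p k, y l ≤ b) :
    ε * ∏ l ∈ (range k).erase i, (t - y l) ≤ c * nodeProd y p t * (b - t) ^ (k - p - 1) := by
  have hi' := mem_Ico.1 hi
  have hs : (range k).erase i = range p ∪ (Ico p k).erase i := by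
    ext l; simp only [mem_erase, mem_range, mem_union, mem_Ico]; omega
  have hdisj : Disjoint (range p) ((Ico p k).erase i) := by
    rw [disjoint_left]; intro l; simp only [mem_erase, mem_range, mem_Ico]; omega
  have hcard : #((Ico p k).erase i) = k - p - 1 := by rw [card_erase_of_mem hi, Nat.card_Ico]
  have hneg : ∏ l ∈ (Ico p k).erase i, (t - y l) =
      (-1) ^ (k - p - 1) * ∏ l ∈ (Ico p k).erase i, (y l - t) := by
    rw [← hcard, ← prod_const, ← prod_mul_distrib]
    exact prod_congr rfl fun l _ => by ring
  have hle : ∏ l ∈ (Ico p k).erase i, (y l - t) ≤ (b - t) ^ (k - p - 1) := by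
    rw [← hcard, ← prod_const]
    exact prod_le_prod (fun l hl => sub_nonneg.2 (h' l (mem_of_mem_erase hl)))
      fun l hl => sub_le_sub_right (hb l (mem_of_mem_erase hl)) _
  have h0 : 0 ≤ ∏ l ∈ (Ico p k).erase i, (y l - t) :=
    prod_nonneg fun l hl => sub_nonneg.2 (h' l (mem_of_mem_erase hl))
  have hQ : 0 ≤ nodeProd y p t := nodeProd_nonneg h
  rw [hs, prod_union hdisj, hneg]
  calc ε * ((∏ l ∈ range p, (t - y l)) * ((-1) ^ (k - p - 1) *
        ∏ l ∈ (Ico p k).erase i, (y l - t)))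
      = ε * (-1) ^ (k - p - 1) * (nodeProd y p t * ∏ l ∈ (Ico p k).erase i, (y l - t)) := by
        unfold nodeProd; ring
    _ ≤ c * (nodeProd y p t * ∏ l ∈ (Ico p k).erase i, (y l - t)) := by gcongr
    _ ≤ c * (nodeProd y p t * (b - t) ^ (k - p - 1)) := by gcongr
    _ = _ := by ring

lemma sum_primitive_sub_le {k : ℕ} (hk : 1 ≤ k) {y : ℕ → ℝ} (hy : Monotone y)
    {A : ℕ → ℝ → ℝ}
    (hA : ∀ i < k, ∀ t, HasDerivAt (A i) (∏ l ∈ (range k).erase i, (t - y l)) t)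
    {c ε : ℝ} (hc0 : 0 ≤ c)
    (hc : ∀ p, 1 ≤ p → p < k → ε * (-1) ^ (k - p - 1) ≤ c * k.choose p) :
    ε * ∑ i ∈ range k, (A i (y i) - A i (y 0)) ≤ c * (y (k - 1) - y 0) ^ k := by
  set b := y (k - 1)
  have hanti (p : ℕ) (hp1 : 1 ≤ p) (hp : p < k) :
      AntitoneOn (fun t => ε * ∑ i ∈ Ico p k, A i t + c * potential k y b p t)
        (Set.Icc (y (p - 1)) (y p)) := by
    have hd (t : ℝ) : HasDerivAt (fun t => ε * ∑ i ∈ Ico p k, A i t + c * potential k y b p t)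
        (ε * ∑ i ∈ Ico p k, ∏ l ∈ (range k).erase i, (t - y l) +
          c * deriv (potential k y b p) t) t :=
      ((HasDerivAt.fun_sum fun i hi => hA i (mem_Ico.1 hi).2 t).const_mul ε).add
        ((differentiable_potential k y b p t).hasDerivAt.const_mul c)
    refine antitoneOn_of_deriv_nonpos (convex_Icc _ _)
      (fun t _ => (hd t).continuousAt.continuousWithinAt)
      (fun t _ => (hd t).differentiableAt.differentiableWithinAt) fun t ht => ?_
    rw [interior_Icc] at ht
    rw [(hd t).deriv]
    have hl : ∀ l < p, y l ≤ t := fun l hl => (hy (by omega)).trans ht.1.le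
    have hl' : ∀ l ∈ Ico p k, t ≤ y l := fun l hl => ht.2.le.trans (hy (mem_Ico.1 hl).1)
    have hlb : ∀ l ∈ Ico p k, y l ≤ b := fun l hl => hy (by have := mem_Ico.1 hl; omega)
    have htb : t ≤ b := ht.2.le.trans (hy (by omega))
    have h1 := mul_le_mul_of_nonneg_left (deriv_potential_le hy hp hl htb) hc0
    have h2 := sum_le_sum fun i hi => neg_one_pow_mul_prod_erase_le (hc p hp1 hp)
      (by positivity) hi hl hl' hlb
    rw [← mul_sum, sum_const, Nat.card_Ico, nsmul_eq_mul] at h2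
    linarith
  have key (p : ℕ) (hp : p < k) :
      ε * (∑ i ∈ range (p + 1), A i (y i) + ∑ i ∈ Ico (p + 1) k, A i (y p)) +
        c * potential k y b (p + 1) (y p) ≤
      ε * ∑ i ∈ range k, A i (y 0) + c * (b - y 0) ^ k := by
    induction p with
    | zero =>
      rw [potential_succ_node, potential_zero, sum_range_one,
        range_eq_Ico k, sum_eq_sum_Ico_succ_bot hp]
    | succ p ih =>
      refine le_trans (le_of_eq_of_le ?_ (add_le_add_right (hanti (p + 1) (by omega) hp
        (Set.left_mem_Icc.2 (hy (by omega))) (Set.right_mem_Icc.2 (hy (by omega)))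
        (hy (by omega))) (ε * ∑ i ∈ range (p + 1), A i (y i)))) (le_of_eq_of_le ?_ (ih (by omega)))
      · beta_reduce
        rw [potential_succ_node, sum_range_succ, sum_eq_sum_Ico_succ_bot hp]
        ring
      · simp only [Nat.add_sub_cancel]
        ring
  have hlast := key (k - 1) (by omega)
  have hpos : 0 ≤ c * potential k y b k (y (k - 1)) :=
    mul_nonneg hc0 (potential_nonneg (fun l hl => hy (by omega)) le_rfl)
  rw [Nat.sub_add_cancel hk, Ico_self, sum_empty, add_zero] at hlast
  rw [sum_sub_distrib, mul_sub]
  linarith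

/-- The primitive, vanishing at `0`, of `t ↦ ∏ l ≠ i, (t - x l)`. -/
noncomputable def kernelPrimitive {k : ℕ} (x : Fin k → ℝ) (i : Fin k) (t : ℝ) : ℝ :=
  ∑ j ∈ range k, (-1 : ℝ) ^ j * (1 / ((k : ℝ) - j)) *
    ∑ S ∈ powersetCard j (univ.erase i), t ^ (k - j) * ∏ l ∈ S, x l

lemma hasDerivAt_kernelPrimitive {k : ℕ} (x : Fin k → ℝ) (i : Fin k) (t : ℝ) :
    HasDerivAt (kernelPrimitive x i) (∏ l ∈ univ.erase i, (t - x l)) t := by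
  have hcard : #(univ.erase i) = k - 1 := by simp [card_erase_of_mem]
  have hk : 0 < k := i.pos
  have hprod : ∏ l ∈ univ.erase i, (t - x l) = ∑ j ∈ range k, (-1 : ℝ) ^ j * (1 / ((k : ℝ) - j)) *
      ∑ S ∈ powersetCard j (univ.erase i), ((k - j : ℕ) * t ^ (k - j - 1)) * ∏ l ∈ S, x l := by
    have h := prod_add (fun l => -x l) (fun _ => t) (univ.erase i)
    simp only [neg_add_eq_sub] at h
    rw [h, sum_powerset, hcard, Nat.sub_add_cancel hk]
    refine sum_congr rfl fun j hj => ?_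
    have hj' := mem_range.1 hj
    rw [mul_sum]
    refine sum_congr rfl fun S hS => ?_
    obtain ⟨hS1, hS2⟩ := mem_powersetCard.1 hS
    rw [prod_neg, prod_const, card_sdiff_of_subset hS1, hcard, hS2, Nat.cast_sub hj'.le,
      Nat.sub_right_comm]
    have : (k : ℝ) - j ≠ 0 := sub_ne_zero.2 (by exact_mod_cast hj'.ne')
    field_simp
  rw [hprod]
  exact HasDerivAt.fun_sum fun j _ => (HasDerivAt.fun_sum fun S _ =>
    (hasDerivAt_pow (k - j) t).mul_const _).const_mul _

lemma kernelPrimitive_zero {k : ℕ} (x : Fin k → ℝ) (i : Fin k) : kernelPrimitive x i 0 = 0 := by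
  refine sum_eq_zero fun j hj => ?_
  have : k - j ≠ 0 := by have := mem_range.1 hj; omega
  simp [zero_pow this]

lemma psi_eq_sum_kernelPrimitive_add {k : ℕ} (hk : 1 ≤ k) (x : Fin k → ℝ) :
    psi k x = ∑ i, kernelPrimitive x i (x i) + ∏ i, (0 - x i) := by
  obtain ⟨n, rfl⟩ := Nat.exists_eq_add_of_le' hk
  have hlast (i : Fin (n + 1)) : ∑ S ∈ powersetCard n (univ.erase i),
      x i ^ (n + 1 - n) * ∏ l ∈ S, x l = ∏ l, x l := by
    have hcard : #(univ.erase i) = n := by simp [card_erase_of_mem]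
    have hself : powersetCard n (univ.erase i) = {univ.erase i} := by
      simpa only [hcard] using powersetCard_self (univ.erase i)
    rw [hself, sum_singleton, Nat.add_sub_cancel_left, pow_one, mul_prod_erase _ _ (mem_univ i)]
  unfold psi kernelPrimitive
  simp only [sum_range_succ, sum_add_distrib, hlast, zero_sub, prod_neg]
  rw [sum_comm]
  simp [mul_sum, pow_succ]
  ring

lemma psi_eq_sum_kernelPrimitive_sub {k : ℕ} (x : Fin k → ℝ) (i₀ : Fin k) :
    psi k x = ∑ i, (kernelPrimitive x i (x i) - kernelPrimitive x i (x i₀)) := by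
  have hd (t : ℝ) : HasDerivAt
      (fun t => ∏ i, (t - x i) - ∑ i, kernelPrimitive x i t) 0 t := by
    have h := (HasDerivAt.fun_finsetProd (u := univ) (f := fun i t => t - x i)
      (f' := fun _ => 1) (x := t) fun i _ => (hasDerivAt_id t).sub_const (x i)).sub
      (HasDerivAt.fun_sum (u := univ) fun i _ => hasDerivAt_kernelPrimitive x i t)
    exact h.congr_deriv (by simp)
  have hconst := is_const_of_deriv_eq_zero (fun t => (hd t).differentiableAt)
    (fun t => (hd t).deriv) 0 (x i₀)
  have hprod : ∏ i, (x i₀ - x i) = 0 := prod_eq_zero (mem_univ i₀) (sub_self _)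
  simp only [kernelPrimitive_zero, sum_const_zero, sub_zero, hprod] at hconst
  rw [psi_eq_sum_kernelPrimitive_add i₀.pos, hconst, sum_sub_distrib]
  ring

lemma mul_psi_le {k : ℕ} (hk : 0 < k) {x : Fin k → ℝ} (hx : Monotone x) {c ε : ℝ}
    (hc0 : 0 ≤ c) (hc : ∀ p, 1 ≤ p → p < k → ε * (-1) ^ (k - p - 1) ≤ c * k.choose p) :
    ε * psi k x ≤ c * (x ⟨k - 1, by omega⟩ - x ⟨0, hk⟩) ^ k := by
  let y : ℕ → ℝ := fun n => x ⟨min n (k - 1), by omega⟩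
  have hy : Monotone y := fun a b hab => hx (Fin.mk_le_mk.2 (min_le_min_right _ hab))
  have hyx (i : Fin k) : y i = x i :=
    congrArg x (Fin.ext (min_eq_left (by have := i.isLt; omega)))
  let A : ℕ → ℝ → ℝ := fun i => if h : i < k then kernelPrimitive x ⟨i, h⟩ else 0
  have hAx (i : Fin k) : A i = kernelPrimitive x i := dif_pos i.isLt
  have hA : ∀ i < k, ∀ t, HasDerivAt (A i) (∏ l ∈ (range k).erase i, (t - y l)) t := by
    intro i hi t
    have hs : (range k).erase i = (univ.erase (⟨i, hi⟩ : Fin k)).map Fin.valEmbedding := by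
      ext l
      simp [map_erase]
    rw [hs, prod_map]
    simp only [Fin.valEmbedding_apply, hyx]
    rw [hAx ⟨i, hi⟩]
    exact hasDerivAt_kernelPrimitive x ⟨i, hi⟩ t
  have h := sum_primitive_sub_le hk hy hA hc0 hc
  rw [← Fin.sum_univ_eq_sum_range (fun i => A i (y i) - A i (y 0))] at h
  have hlast : y (k - 1) = x ⟨k - 1, by omega⟩ := hyx ⟨k - 1, by omega⟩
  have hzero : y 0 = x ⟨0, hk⟩ := hyx ⟨0, hk⟩
  simp only [hAx, hyx, hzero, hlast] at h
  rwa [psi_eq_sum_kernelPrimitive_sub x ⟨0, hk⟩]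

lemma choose_le_choose_of_le_of_add_le {k m r : ℕ} (hmr : m ≤ r) (hr : r + m ≤ k) :
    k.choose m ≤ k.choose r := by
  have half {r : ℕ} (hmr : m ≤ r) (hr : r ≤ k / 2) : k.choose m ≤ k.choose r := by
    induction r, hmr using Nat.le_induction with
    | base => rfl
    | succ r _ ih => exact (ih (by omega)).trans (Nat.choose_le_succ_of_lt_half_left (by omega))
  rcases le_or_gt r (k / 2) with h | h
  · exact half hmr h
  · rw [← Nat.choose_symm (show r ≤ k by omega)]
    exact half (by omega) (by omega)

/-- Let `k ≥ 3` and `x₁ ≤ x₂ ≤ ⋯ ≤ x_k` be reals with `x_k − x₁ = d`. Then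
`−d^k / C(k,m) ≤ ψ_k(x₁,…,x_k) ≤ d^k / k`, where `m = 2` if `k` is even and `m = 1`
if `k` is odd (i.e. `m = (3 + (−1)^k)/2`). -/
theorem stmt4 (k : ℕ) (hk : 3 ≤ k) (x : Fin k → ℝ) (hmono : Monotone x)
    (d : ℝ) (hd : x ⟨k - 1, by omega⟩ - x ⟨0, by omega⟩ = d)
    (m : ℕ) (hm : m = if Even k then 2 else 1) :
    -(d ^ k) / (k.choose m : ℝ) ≤ psi k x ∧ psi k x ≤ d ^ k / (k : ℝ) := by
  have hpos : (0 : ℝ) < k := by positivity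
  have hfirst (p : ℕ) (hp1 : 1 ≤ p) (hp : p < k) : (1 : ℝ) ≤ 1 / k * k.choose p := by
    have h : k.choose 1 ≤ k.choose p := choose_le_choose_of_le_of_add_le hp1 hp
    rw [Nat.choose_one_right] at h
    rw [one_div_mul_eq_div, one_le_div hpos]
    exact_mod_cast h
  constructor
  · have hm0 : (0 : ℝ) < k.choose m := by
      exact_mod_cast Nat.choose_pos (by split_ifs at hm <;> omega)
    have h := mul_psi_le (by omega) hmono (c := 1 / (k.choose m : ℝ)) (ε := -1) (by positivity)
      fun p hp1 hp => ?_
    · rw [hd] at h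
      rw [one_div_mul_eq_div] at h
      rw [neg_div]
      linarith
    · rcases Nat.even_or_odd (k - p - 1) with he | ho
      · rw [he.neg_one_pow]
        exact le_trans (by norm_num) (by positivity : (0 : ℝ) ≤ _)
      · rw [ho.neg_one_pow, neg_mul_neg, one_mul, one_div_mul_eq_div, one_le_div hm0]
        have hle : k.choose m ≤ k.choose p := by
          apply choose_le_choose_of_le_of_add_le <;> split_ifs at hm <;> grind
        exact_mod_cast hle
  · have h := mul_psi_le (by omega) hmono (c := 1 / (k : ℝ)) (ε := 1) (by positivity)
      fun p hp1 hp => ?_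
    · rw [hd, one_mul, one_div_mul_eq_div] at h
      exact h
    · refine le_trans ?_ (hfirst p hp1 hp)
      rcases neg_one_pow_eq_or ℝ (k - p - 1) with h | h <;> rw [h] <;> norm_num
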